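/- For any finite-dimensional complex Hilbert space ℋ, for every α ∈ (0,∞) and z ∈ (0,∞), the Rényi (α,z)-divergence (ρ,σ) ↦ D_{α,z}(ρ‖σ) (with D_{1,z} := D^Um, the Umegaki relative entropy) is lower semicontinuous on the set of pairs of nonzero positive semidefinite operators on ℋ. Moreover, the max-relative entropy (ρ,σ) ↦ D_max(ρ‖σ) is lower semicontinuous on the same set. -/

import Mathlib

open Filter Set Topology
open scoped ComplexOrder

noncomputable section

namespace QRenyi

attribute [local instance] Classical.propDecidable

variable {ι : Type*} [Fintype ι] [DecidableEq ι]

/-- Apply a real function to the eigenvalues of a Hermitian matrix (functional calculus);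
junk value `0` for non-Hermitian matrices. -/
noncomputable def hermApply (f : ℝ → ℝ) (A : Matrix ι ι ℂ) : Matrix ι ι ℂ :=
  if hA : A.IsHermitian then hA.cfc f else 0

/-- Real power of a positive semidefinite matrix, taken on its support:
`t ↦ t ^ x` is applied to the nonzero eigenvalues and `0` is mapped to `0`.
In particular `matPow A 0` is the support projection of `A`. -/
noncomputable def matPow (A : Matrix ι ι ℂ) (x : ℝ) : Matrix ι ι ℂ :=
  hermApply (fun t => if t = 0 then 0 else t ^ x) A

/-- Logarithm of a positive semidefinite matrix taken on its support
(`Real.log 0 = 0` in Mathlib, matching the convention `log̃ 0 = 0`). -/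
noncomputable def matLog (A : Matrix ι ι ℂ) : Matrix ι ι ℂ :=
  hermApply Real.log A

/-- `supp ρ ≤ supp σ`, expressed (for PSD matrices) as inclusion of kernels. -/
def suppLE (ρ σ : Matrix ι ι ℂ) : Prop :=
  ∀ v : ι → ℂ, σ.mulVec v = 0 → ρ.mulVec v = 0

/-- The Loewner (positive semidefinite) order. -/
def loewnerLE (A B : Matrix ι ι ℂ) : Prop := (B - A).PosSemidef

/-- Real part of the trace. -/
noncomputable def reTrace (A : Matrix ι ι ℂ) : ℝ := A.trace.re

/-- The trace quantity `Tr ((σ^{(1-α)/(2z)} ρ^{α/z} σ^{(1-α)/(2z)})^z)` (a real number). -/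
noncomputable def Qaz (α z : ℝ) (ρ σ : Matrix ι ι ℂ) : ℝ :=
  reTrace (matPow (matPow σ ((1 - α) / (2 * z)) * matPow ρ (α / z) *
    matPow σ ((1 - α) / (2 * z))) z)

/-- The Rényi `(α,z)`-divergence (for `α ≠ 1`), with values in `EReal = ℝ ∪ {±∞}`.
It equals `(α-1)⁻¹ (log Q_{α,z}(ρ‖σ) - log Tr ρ)`; it is `+∞` when `α > 1` and
`supp ρ ≰ supp σ`, and also `+∞` when `α < 1` and `Q_{α,z}(ρ‖σ) = 0`
(i.e. `(α-1)⁻¹ log 0 = +∞`). -/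
noncomputable def Daz (α z : ℝ) (ρ σ : Matrix ι ι ℂ) : EReal :=
  if (suppLE ρ σ ∨ α < 1) ∧ Qaz α z ρ σ ≠ 0 then
    (((α - 1)⁻¹ * (Real.log (Qaz α z ρ σ) - Real.log (reTrace ρ)) : ℝ) : EReal)
  else ⊤

/-- The (normalized) Umegaki relative entropy. -/
noncomputable def DUm (ρ σ : Matrix ι ι ℂ) : EReal :=
  if suppLE ρ σ then
    (((reTrace ρ)⁻¹ * reTrace (ρ * (matLog ρ - matLog σ)) : ℝ) : EReal)
  else ⊤

/-- The Rényi `(α,z)`-divergence, with `D_{1,z} := D^Um`. -/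
noncomputable def Dfull (α z : ℝ) (ρ σ : Matrix ι ι ℂ) : EReal :=
  if α = 1 then DUm ρ σ else Daz α z ρ σ

/-- The max-relative entropy `D_max(ρ‖σ) = log inf {λ > 0 : ρ ≤ λ σ}`. -/
noncomputable def Dmax (ρ σ : Matrix ι ι ℂ) : EReal :=
  if ∃ c : ℝ, 0 < c ∧ loewnerLE ρ (c • σ) then
    ((Real.log (sInf {c : ℝ | 0 < c ∧ loewnerLE ρ (c • σ)}) : ℝ) : EReal)
  else ⊤

/-- The classical quantity `Q_α^cl(ρ‖σ) = ∑_x ρ(x)^α σ(x)^{1-α}` (with `0^t = 0` for `t ≠ 0`). -/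
noncomputable def Qcl {X : Type*} [Fintype X] (α : ℝ) (ρ σ : X → ℝ) : ℝ :=
  ∑ x, ρ x ^ α * σ x ^ (1 - α)

/-- Absolute continuity `ρ ≪ σ` for functions on a finite set. -/
def acl {X : Type*} (ρ σ : X → ℝ) : Prop := ∀ x, σ x = 0 → ρ x = 0

/-- The classical Rényi `α`-divergence, with values in `EReal`; for `α = 1` it is the
(normalized) Kullback-Leibler divergence. -/
noncomputable def Dcl {X : Type*} [Fintype X] (α : ℝ) (ρ σ : X → ℝ) : EReal :=
  if α = 1 then
    (if acl ρ σ then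
      ((((∑ x, ρ x)⁻¹ * ∑ x, ρ x * (Real.log (ρ x) - Real.log (σ x))) : ℝ) : EReal)
     else ⊤)
  else if (acl ρ σ ∨ α < 1) ∧ Qcl α ρ σ ≠ 0 then
    ((((α - 1)⁻¹ * (Real.log (Qcl α ρ σ) - Real.log (∑ x, ρ x))) : ℝ) : EReal)
  else ⊤

/-- The measured Rényi `α`-divergence: supremum over all finite-outcome POVMs. -/
noncomputable def Dmeas (α : ℝ) (ρ σ : Matrix ι ι ℂ) : EReal :=
  ⨆ (k : ℕ) (M : Fin k → Matrix ι ι ℂ)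
    (_ : (∀ i, (M i).PosSemidef) ∧ ∑ i, M i = 1),
    Dcl α (fun i => reTrace (M i * ρ)) (fun i => reTrace (M i * σ))

/-- A `κ`-function: a continuous nonnegative function on `[0,∞)` with
`limsup_{x→0⁺} f(x) x^{-κ} < ∞`. -/
def IsKappaFunction (κ : ℝ) (f : ℝ → ℝ) : Prop :=
  ContinuousOn f (Set.Ici 0) ∧ (∀ x ∈ Set.Ici (0 : ℝ), 0 ≤ f x) ∧
    ∃ M : ℝ, ∀ᶠ x in 𝓝[>] (0 : ℝ), f x ≤ M * x ^ κ

/-- A strict `κ`-function: a `κ`-function with `liminf_{x→0⁺} f(x) x^{-κ} > 0`. -/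
def IsStrictKappaFunction (κ : ℝ) (f : ℝ → ℝ) : Prop :=
  IsKappaFunction κ f ∧ ∃ c : ℝ, 0 < c ∧ ∀ᶠ x in 𝓝[>] (0 : ℝ), c * x ^ κ ≤ f x

/-- Nonzero PSD matrix predicate. -/
def PSDne (A : Matrix ι ι ℂ) : Prop := A.PosSemidef ∧ A ≠ 0


/-- The scalar function underlying `matPow`. -/
def suppPow (x t : ℝ) : ℝ := if t = 0 then 0 else t ^ x

lemma suppPow_nonneg {x t : ℝ} (ht : 0 ≤ t) : 0 ≤ suppPow x t := by
  unfold suppPow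
  split_ifs
  · exact le_rfl
  · positivity

lemma suppPow_of_pos {x : ℝ} (hx : 0 < x) : suppPow x = fun t => t ^ x := by
  funext t
  unfold suppPow
  split_ifs with h
  · rw [h, Real.zero_rpow hx.ne']
  · rfl

lemma suppPow_mul {t : ℝ} (ht : 0 ≤ t) (x y : ℝ) :
    suppPow x t * suppPow y t = suppPow (x + y) t := by
  unfold suppPow
  split_ifs with h
  · simp
  · rw [Real.rpow_add (lt_of_le_of_ne ht (Ne.symm h))]

lemma hermApply_eq_cfc (f : ℝ → ℝ) (A : Matrix ι ι ℂ) : hermApply f A = cfc f A := by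
  unfold hermApply
  split_ifs with hA
  · rw [hA.cfc_eq]
  · exact (cfc_apply_of_not_predicate A hA).symm

lemma matPow_eq_cfc (A : Matrix ι ι ℂ) (x : ℝ) : matPow A x = cfc (suppPow x) A :=
  hermApply_eq_cfc _ A

lemma continuousOn_real_spectrum (f : ℝ → ℝ) (A : Matrix ι ι ℂ) :
    ContinuousOn f (spectrum ℝ A) :=
  Matrix.finite_real_spectrum.continuousOn f

lemma spectrum_nonneg_of_posSemidef {A : Matrix ι ι ℂ} (hA : A.PosSemidef) {t : ℝ}
    (ht : t ∈ spectrum ℝ A) : 0 ≤ t := by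
  rw [hA.1.spectrum_real_eq_range_eigenvalues] at ht
  obtain ⟨i, rfl⟩ := ht
  exact hA.eigenvalues_nonneg i

lemma cfc_mul_cfc (f g : ℝ → ℝ) (A : Matrix ι ι ℂ) :
    cfc f A * cfc g A = cfc (fun t => f t * g t) A :=
  (cfc_mul f g A (continuousOn_real_spectrum f A) (continuousOn_real_spectrum g A)).symm

lemma cfc_isHermitian (f : ℝ → ℝ) (A : Matrix ι ι ℂ) : (cfc f A).IsHermitian :=
  cfc_predicate f A

/-- The diagonal form of the functional calculus. -/
lemma cfc_eq_conj {A : Matrix ι ι ℂ} (hA : A.IsHermitian) (f : ℝ → ℝ) :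
    cfc f A = (hA.eigenvectorUnitary : Matrix ι ι ℂ) *
      Matrix.diagonal (fun i => (f (hA.eigenvalues i) : ℂ)) *
      (hA.eigenvectorUnitary : Matrix ι ι ℂ).conjTranspose := by
  rw [hA.cfc_eq, Matrix.IsHermitian.cfc, Unitary.conjStarAlgAut_apply]
  rfl

lemma posSemidef_cfc {A : Matrix ι ι ℂ} (hA : A.PosSemidef) {f : ℝ → ℝ}
    (hf : ∀ t, 0 ≤ t → 0 ≤ f t) : (cfc f A).PosSemidef := by
  rw [cfc_eq_conj hA.1]
  refine Matrix.PosSemidef.mul_mul_conjTranspose_same ?_ _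
  refine Matrix.PosSemidef.diagonal fun i => ?_
  exact Complex.zero_le_real.mpr (hf _ (hA.eigenvalues_nonneg i))

lemma matPow_posSemidef {A : Matrix ι ι ℂ} (hA : A.PosSemidef) (x : ℝ) :
    (matPow A x).PosSemidef := by
  rw [matPow_eq_cfc]
  exact posSemidef_cfc hA fun t => suppPow_nonneg

lemma matPow_mul {A : Matrix ι ι ℂ} (hA : A.PosSemidef) (x y : ℝ) :
    matPow A x * matPow A y = matPow A (x + y) := by
  simp only [matPow_eq_cfc, cfc_mul_cfc]
  exact cfc_congr fun t ht => suppPow_mul (spectrum_nonneg_of_posSemidef hA ht) x y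

lemma matPow_one {A : Matrix ι ι ℂ} (hA : A.PosSemidef) : matPow A 1 = A := by
  rw [matPow_eq_cfc, suppPow_of_pos one_pos]
  simp only [Real.rpow_one]
  exact cfc_id' ℝ A hA.1

/-- The weight of `ρ` on the `i`-th eigenvector of `σ`. -/
def eigenWeight {σ : Matrix ι ι ℂ} (hσ : σ.IsHermitian) (ρ : Matrix ι ι ℂ) (i : ι) : ℝ :=
  (((hσ.eigenvectorUnitary : Matrix ι ι ℂ).conjTranspose * ρ *
    (hσ.eigenvectorUnitary : Matrix ι ι ℂ)) i i).re

/-- The trace of `ρ * f(σ)` in the eigenbasis of `σ`. -/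
lemma reTrace_mul_cfc {σ : Matrix ι ι ℂ} (hσ : σ.IsHermitian) (ρ : Matrix ι ι ℂ) (f : ℝ → ℝ) :
    reTrace (ρ * cfc f σ) = ∑ i, f (hσ.eigenvalues i) * eigenWeight hσ ρ i := by
  rw [reTrace, cfc_eq_conj hσ, ← Matrix.mul_assoc, Matrix.trace_mul_comm, ← Matrix.mul_assoc,
    ← Matrix.mul_assoc, Matrix.trace, Complex.re_sum]
  refine Finset.sum_congr rfl fun i _ => ?_
  rw [Matrix.diag_apply, Matrix.mul_diagonal, Complex.re_mul_ofReal, mul_comm, eigenWeight]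

lemma reTrace_cfc {A : Matrix ι ι ℂ} (hA : A.IsHermitian) (f : ℝ → ℝ) :
    reTrace (cfc f A) = ∑ i, f (hA.eigenvalues i) := by
  rw [← one_mul (cfc f A), reTrace_mul_cfc hA]
  refine Finset.sum_congr rfl fun i _ => ?_
  have h : (hA.eigenvectorUnitary : Matrix ι ι ℂ).conjTranspose *
      (hA.eigenvectorUnitary : Matrix ι ι ℂ) = 1 :=
    Unitary.star_mul_self_of_mem hA.eigenvectorUnitary.2
  rw [eigenWeight, Matrix.mul_one, h]
  simp

set_option linter.unusedSectionVars false in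
lemma reTrace_pos {A : Matrix ι ι ℂ} (hA : PSDne A) : 0 < reTrace A := by
  have h := hA.1.trace_nonneg
  have h0 : A.trace ≠ 0 := fun h => hA.2 (hA.1.trace_eq_zero_iff.mp h)
  have := lt_of_le_of_ne h (Ne.symm h0)
  exact (Complex.lt_def.mp this).1

set_option linter.unusedSectionVars false in
lemma reTrace_nonneg {A : Matrix ι ι ℂ} (hA : A.PosSemidef) : 0 ≤ reTrace A :=
  (Complex.le_def.mp hA.trace_nonneg).1

set_option linter.unusedSectionVars false in
lemma continuous_reTrace : Continuous (reTrace : Matrix ι ι ℂ → ℝ) :=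
  Complex.continuous_re.comp continuous_id.matrix_trace

set_option linter.unusedSectionVars false in
lemma isClosed_posSemidef : IsClosed {A : Matrix ι ι ℂ | A.PosSemidef} := by
  have : {A : Matrix ι ι ℂ | A.PosSemidef} =
      {A | A.conjTranspose = A} ∩ ⋂ v : ι → ℂ, {A | 0 ≤ star v ⬝ᵥ A.mulVec v} := by
    ext A
    simp only [mem_inter_iff, mem_ofPred_eq, mem_iInter]
    exact Matrix.posSemidef_iff_dotProduct_mulVec
  rw [this]
  refine IsClosed.inter (isClosed_eq (by fun_prop) continuous_id) (isClosed_iInter fun v => ?_)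
  exact isClosed_le continuous_const
    (continuous_const.dotProduct (continuous_id.matrix_mulVec continuous_const))

open scoped Matrix.Norms.L2Operator in
lemma tendsto_cfc_of_posSemidef {X : Type*} {l : Filter X} {a : X → Matrix ι ι ℂ}
    {A : Matrix ι ι ℂ} {f : ℝ → ℝ} (hf : ContinuousOn f (Ici 0)) (ha : Tendsto a l (𝓝 A))
    (hpos : ∀ᶠ x in l, (a x).PosSemidef) (hA : A.PosSemidef) :
    Tendsto (fun x => cfc f (a x)) l (𝓝 (cfc f A)) := by
  have key : ∀ B : Matrix ι ι ℂ, B.PosSemidef → ‖B‖ ≤ ‖A‖ + 1 →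
      spectrum ℝ B ⊆ Icc 0 (‖A‖ + 1) := by
    intro B hB hn t ht
    refine ⟨spectrum_nonneg_of_posSemidef hB ht, ?_⟩
    have h1 := spectrum.norm_le_norm_mul_of_mem ht
    have h2 : ‖(1 : Matrix ι ι ℂ)‖ ≤ 1 := by
      rw [← Matrix.diagonal_one, Matrix.l2_opNorm_diagonal]
      exact (pi_norm_le_iff_of_nonneg zero_le_one).mpr fun i => by simp
    calc t ≤ ‖t‖ := le_abs_self t
      _ ≤ ‖B‖ * ‖(1 : Matrix ι ι ℂ)‖ := h1
      _ ≤ ‖B‖ * 1 := by gcongr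
      _ ≤ _ := by linarith
  refine Filter.Tendsto.cfc (p := IsSelfAdjoint) (s := Icc 0 (‖A‖ + 1)) isCompact_Icc f ha ?_
    (hpos.mono fun x hx => hx.1) (key A hA (by linarith)) hA.1 (hf.mono Icc_subset_Ici_self)
  have hn : ∀ᶠ x in l, ‖a x‖ < ‖A‖ + 1 :=
    (ha.norm).eventually_lt_const (by linarith)
  filter_upwards [hpos, hn] with x h1 h2 using key _ h1 h2.le

open scoped Matrix.Norms.L2Operator in
/-- Positive semidefinite matrices with bounded eigenvalues form a compact set. -/
lemma isCompact_posSemidef_eigenvalues_le (M : ℝ) : ∃ K : Set (Matrix ι ι ℂ), IsCompact K ∧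
    ∀ A : Matrix ι ι ℂ, ∀ hA : A.PosSemidef, (∀ i, hA.1.eigenvalues i ≤ M) → A ∈ K := by
  have : ProperSpace (Matrix ι ι ℂ) := FiniteDimensional.proper ℂ _
  refine ⟨Metric.closedBall 0 |M|, isCompact_closedBall _ _, fun A hA h => ?_⟩
  rw [mem_closedBall_zero_iff, ← cfc_id ℝ A hA.1]
  refine norm_cfc_le (abs_nonneg M) fun t ht => ?_
  rw [hA.1.spectrum_real_eq_range_eigenvalues] at ht
  obtain ⟨i, rfl⟩ := ht
  rw [id, Real.norm_of_nonneg (hA.eigenvalues_nonneg i)]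
  exact (h i).trans (le_abs_self M)

/-- The quadratic form of a Hermitian matrix in the coordinates of its eigenbasis. -/
lemma re_dotProduct_mulVec {A : Matrix ι ι ℂ} (hA : A.IsHermitian) (v : ι → ℂ) :
    (star v ⬝ᵥ A.mulVec v).re = ∑ i, hA.eigenvalues i *
      Complex.normSq (((hA.eigenvectorUnitary : Matrix ι ι ℂ).conjTranspose.mulVec v) i) := by
  have h : A = cfc (fun t : ℝ => t) A := (cfc_id' ℝ A hA).symm
  set U : Matrix ι ι ℂ := (hA.eigenvectorUnitary : Matrix ι ι ℂ) with hU
  conv_lhs => rw [h, cfc_eq_conj hA]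
  rw [← hU, ← Matrix.mulVec_mulVec, ← Matrix.mulVec_mulVec, Matrix.dotProduct_mulVec,
    show Matrix.vecMul (star v) U = star (U.conjTranspose.mulVec v) by
      rw [Matrix.star_mulVec, Matrix.conjTranspose_conjTranspose], dotProduct, Complex.re_sum]
  refine Finset.sum_congr rfl fun i _ => ?_
  rw [Matrix.mulVec_diagonal, Pi.star_apply, mul_left_comm, Complex.re_ofReal_mul]
  congr 1
  rw [Complex.star_def, ← Complex.normSq_eq_conj_mul_self, Complex.ofReal_re]

lemma sum_normSq_eigenvectorUnitary {A : Matrix ι ι ℂ} (hA : A.IsHermitian) (v : ι → ℂ) :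
    ∑ i, Complex.normSq (((hA.eigenvectorUnitary : Matrix ι ι ℂ).conjTranspose.mulVec v) i) =
      (star v ⬝ᵥ v).re := by
  set U : Matrix ι ι ℂ := (hA.eigenvectorUnitary : Matrix ι ι ℂ) with hU
  have h : U * U.conjTranspose = 1 := Unitary.mul_star_self_of_mem hA.eigenvectorUnitary.2
  have : star v ⬝ᵥ v = star (U.conjTranspose.mulVec v) ⬝ᵥ U.conjTranspose.mulVec v := by
    rw [Matrix.star_mulVec, Matrix.conjTranspose_conjTranspose, ← Matrix.dotProduct_mulVec,
      Matrix.mulVec_mulVec, h, Matrix.one_mulVec]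
  rw [this, dotProduct, Complex.re_sum]
  refine Finset.sum_congr rfl fun i _ => ?_
  rw [Pi.star_apply, Complex.star_def, ← Complex.normSq_eq_conj_mul_self, Complex.ofReal_re]

/-- Weyl monotonicity: if the quadratic form of `A` is dominated by that of `B` on the range of
`A`, then each ordered eigenvalue of `A` is at most the corresponding one of `B`. -/
lemma eigenvalues₀_le {A B : Matrix ι ι ℂ} (hA : A.PosSemidef) (hB : B.PosSemidef)
    (h : ∀ w, (star (A.mulVec w) ⬝ᵥ A.mulVec (A.mulVec w)).re ≤
      (star (A.mulVec w) ⬝ᵥ B.mulVec (A.mulVec w)).re) (k : Fin (Fintype.card ι)) :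
    hA.1.eigenvalues₀ k ≤ hB.1.eigenvalues₀ k := by
  by_contra! hlt
  let e : Fin (Fintype.card ι) ≃ ι := Fintype.equivOfCardEq (Fintype.card_fin _)
  have heA : ∀ j, hA.1.eigenvalues (e j) = hA.1.eigenvalues₀ j := fun j => by
    simp [Matrix.IsHermitian.eigenvalues, e]
  have heB : ∀ j, hB.1.eigenvalues (e j) = hB.1.eigenvalues₀ j := fun j => by
    simp [Matrix.IsHermitian.eigenvalues, e]
  set U : Matrix ι ι ℂ := (hA.1.eigenvectorUnitary : Matrix ι ι ℂ) with hU
  set V : Matrix ι ι ℂ := (hB.1.eigenvectorUnitary : Matrix ι ι ℂ) with hV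
  have hUU : U * U.conjTranspose = 1 := Unitary.mul_star_self_of_mem hA.1.eigenvectorUnitary.2
  let T : (ι → ℂ) →ₗ[ℂ] ({j : Fin (Fintype.card ι) // j ≠ k} → ℂ) :=
    LinearMap.pi fun j => if k < j.1
      then LinearMap.proj (e j.1) ∘ₗ U.conjTranspose.mulVecLin
      else LinearMap.proj (e j.1) ∘ₗ V.conjTranspose.mulVecLin
  have hT : T.ker ≠ ⊥ := by
    apply LinearMap.ker_ne_bot_of_finrank_lt
    rw [Module.finrank_fintype_fun_eq_card, Module.finrank_fintype_fun_eq_card,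
      Fintype.card_subtype_compl, Fintype.card_subtype_eq, Fintype.card_fin]
    have := k.pos
    omega
  obtain ⟨v, hv, hv0⟩ := Submodule.exists_mem_ne_zero_of_ne_bot hT
  have hTv : ∀ j : {j : Fin (Fintype.card ι) // j ≠ k}, T v j = 0 := fun j =>
    congrFun (LinearMap.mem_ker.mp hv) j
  have hvA : ∀ j, k < j → U.conjTranspose.mulVec v (e j) = 0 := fun j hj => by
    simpa [T, hj] using hTv ⟨j, hj.ne'⟩
  have hvB : ∀ j, j < k → V.conjTranspose.mulVec v (e j) = 0 := fun j hj => by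
    simpa [T, hj.not_gt] using hTv ⟨j, hj.ne⟩
  have hk0 : 0 < hA.1.eigenvalues₀ k := by
    refine lt_of_le_of_lt ?_ hlt
    rw [← heB]
    exact hB.eigenvalues_nonneg _
  obtain ⟨w, hw⟩ : ∃ w, A.mulVec w = v := by
    refine ⟨(cfc (fun t : ℝ => t⁻¹) A).mulVec v, ?_⟩
    have h1 := cfc_mul_cfc (fun t : ℝ => t) (fun t => t⁻¹) A
    have hid : cfc (fun t : ℝ => t) A = A := cfc_id' ℝ A hA.1
    rw [hid] at h1
    rw [Matrix.mulVec_mulVec, h1, cfc_eq_conj hA.1, ← hU, ← Matrix.mulVec_mulVec,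
      ← Matrix.mulVec_mulVec]
    conv_rhs => rw [← Matrix.one_mulVec v, ← hUU, ← Matrix.mulVec_mulVec]
    congr 1
    ext i
    obtain ⟨j, rfl⟩ := e.surjective i
    rw [Matrix.mulVec_diagonal]
    rcases lt_or_ge k j with hj | hj
    · rw [hvA j hj, mul_zero]
    · have : 0 < hA.1.eigenvalues (e j) := by
        rw [heA]
        exact hk0.trans_le (hA.1.eigenvalues₀_antitone hj)
      rw [mul_inv_cancel₀ this.ne', Complex.ofReal_one, one_mul]
  have hn : 0 < (star v ⬝ᵥ v).re :=
    (Complex.lt_def.mp (Matrix.dotProduct_star_self_pos_iff.mpr hv0)).1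
  have h1 : hA.1.eigenvalues₀ k * (star v ⬝ᵥ v).re ≤ (star v ⬝ᵥ A.mulVec v).re := by
    rw [re_dotProduct_mulVec hA.1, ← sum_normSq_eigenvectorUnitary hA.1, Finset.mul_sum]
    refine Finset.sum_le_sum fun i _ => ?_
    obtain ⟨j, rfl⟩ := e.surjective i
    rcases lt_or_ge k j with hj | hj
    · rw [← hU, hvA j hj]
      simp
    · rw [heA]
      exact mul_le_mul_of_nonneg_right (hA.1.eigenvalues₀_antitone hj) (Complex.normSq_nonneg _)
  have h2 : (star v ⬝ᵥ B.mulVec v).re ≤ hB.1.eigenvalues₀ k * (star v ⬝ᵥ v).re := by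
    rw [re_dotProduct_mulVec hB.1, ← sum_normSq_eigenvectorUnitary hB.1, Finset.mul_sum]
    refine Finset.sum_le_sum fun i _ => ?_
    obtain ⟨j, rfl⟩ := e.surjective i
    rcases lt_or_ge j k with hj | hj
    · rw [← hV, hvB j hj]
      simp
    · rw [heB]
      exact mul_le_mul_of_nonneg_right (hB.1.eigenvalues₀_antitone hj) (Complex.normSq_nonneg _)
  have h3 := h w
  rw [hw] at h3
  have := mul_lt_mul_of_pos_right hlt hn
  linarith

/-- Compressing by a Hermitian idempotent does not increase the trace of a monotone function. -/
lemma reTrace_cfc_compression_le {P Y : Matrix ι ι ℂ} (hP : P.IsHermitian) (hPP : P * P = P)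
    (hY : Y.PosSemidef) {f : ℝ → ℝ} (hf : MonotoneOn f (Ici 0)) :
    reTrace (cfc f (P * Y * P)) ≤ reTrace (cfc f Y) := by
  have hA : (P * Y * P).PosSemidef := by
    have := hY.mul_mul_conjTranspose_same P
    rwa [hP.eq] at this
  have hPA : P * (P * Y * P) = P * Y * P := by
    rw [← Matrix.mul_assoc, ← Matrix.mul_assoc, hPP]
  have key : ∀ w, (star ((P * Y * P).mulVec w) ⬝ᵥ (P * Y * P).mulVec ((P * Y * P).mulVec w)).re ≤
      (star ((P * Y * P).mulVec w) ⬝ᵥ Y.mulVec ((P * Y * P).mulVec w)).re := by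
    intro w
    have hv : P.mulVec ((P * Y * P).mulVec w) = (P * Y * P).mulVec w := by
      rw [Matrix.mulVec_mulVec, hPA]
    set v := (P * Y * P).mulVec w
    have hv' : Matrix.vecMul (star v) P = star v := by
      conv_rhs => rw [← hv, Matrix.star_mulVec, hP.eq]
    rw [← Matrix.mulVec_mulVec, ← Matrix.mulVec_mulVec, hv, Matrix.dotProduct_mulVec, hv']
  rw [reTrace_cfc hA.1, reTrace_cfc hY.1]
  let e : Fin (Fintype.card ι) ≃ ι := Fintype.equivOfCardEq (Fintype.card_fin _)
  refine Finset.sum_le_sum fun i _ => ?_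
  exact hf (hA.eigenvalues_nonneg i) (hY.eigenvalues_nonneg i) (eigenvalues₀_le hA hY key _)

/-- Lower semicontinuity of an extended-real function, tested along ultrafilters. -/
lemma lowerSemicontinuousOn_of_ultrafilter {X : Type*} [TopologicalSpace X] {f : X → EReal}
    {s : Set X} (h : ∀ x ∈ s, ∀ U : Ultrafilter X, (U : Filter X) ≤ 𝓝[s] x →
      ∀ y : ℝ, (∀ᶠ x' in (U : Filter X), f x' ≤ y) → f x ≤ y) :
    LowerSemicontinuousOn f s := by
  intro x hx y hy
  obtain ⟨r, h1, h2⟩ := EReal.lt_iff_exists_real_btwn.mp hy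
  by_contra hc
  have hfr : ∃ᶠ x' in 𝓝[s] x, x' ∈ {x' | f x' ≤ r} :=
    (not_eventually.mp hc).mono fun x' hx' => (not_lt.mp hx').trans h1.le
  have : (𝓝[s] x ⊓ 𝓟 {x' | f x' ≤ r}).NeBot := frequently_mem_iff_neBot.mp hfr
  have hU := Ultrafilter.of_le (𝓝[s] x ⊓ 𝓟 {x' | f x' ≤ r})
  refine (h x hx (Ultrafilter.of _) (hU.trans inf_le_left) r ?_).not_gt h2
  exact le_principal_iff.mp (hU.trans inf_le_right)

set_option linter.unusedSectionVars false in
/-- Closedness of the sublevel sets of `Dmax`. -/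
lemma Dmax_le_of_tendsto {ρ σ : Matrix ι ι ℂ} (hρ : PSDne ρ) (hσ : PSDne σ)
    {U : Filter (Matrix ι ι ℂ × Matrix ι ι ℂ)} [U.NeBot] (h1 : Tendsto Prod.fst U (𝓝 ρ))
    (h2 : Tendsto Prod.snd U (𝓝 σ)) (hU : ∀ᶠ p in U, PSDne p.1 ∧ PSDne p.2) {y : ℝ}
    (hy : ∀ᶠ p in U, Dmax p.1 p.2 ≤ y) : Dmax ρ σ ≤ y := by
  have trace_le : ∀ {ρ σ : Matrix ι ι ℂ} {c : ℝ}, loewnerLE ρ (c • σ) →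
      reTrace ρ ≤ c * reTrace σ := by
    intro ρ σ c hc
    have := reTrace_nonneg hc
    rw [reTrace, Matrix.trace_sub, Matrix.trace_smul, Complex.sub_re, Complex.smul_re] at this
    simpa [reTrace] using this
  have inf_pos : ∀ {ρ σ : Matrix ι ι ℂ}, PSDne ρ → PSDne σ →
      (∃ c : ℝ, 0 < c ∧ loewnerLE ρ (c • σ)) →
      0 < sInf {c : ℝ | 0 < c ∧ loewnerLE ρ (c • σ)} := by
    intro ρ σ hρ hσ hne
    refine lt_of_lt_of_le (div_pos (reTrace_pos hρ) (reTrace_pos hσ)) (le_csInf hne ?_)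
    rintro c ⟨-, hc⟩
    exact (div_le_iff₀ (reTrace_pos hσ)).mpr (trace_le hc)
  have bdd : ∀ {ρ σ : Matrix ι ι ℂ}, BddBelow {c : ℝ | 0 < c ∧ loewnerLE ρ (c • σ)} :=
    ⟨0, fun c hc => hc.1.le⟩
  have hle : ∀ δ : ℝ, 0 < δ → loewnerLE ρ ((Real.exp y + δ) • σ) := by
    intro δ hδ
    refine isClosed_posSemidef.mem_of_tendsto ((h2.const_smul (Real.exp y + δ)).sub h1) ?_
    filter_upwards [hy, hU] with p hp ⟨hp1, hp2⟩
    unfold Dmax at hp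
    split_ifs at hp with hne
    · rw [EReal.coe_le_coe_iff, Real.log_le_iff_le_exp (inf_pos hp1 hp2 hne)] at hp
      obtain ⟨c, ⟨-, hc⟩, hcy⟩ := exists_lt_of_csInf_lt
        (b := Real.exp y + δ) hne (lt_of_le_of_lt hp (lt_add_of_pos_right _ hδ))
      have := hc.add (hp2.1.smul (sub_nonneg.mpr hcy.le))
      rwa [sub_smul, sub_add_sub_comm, add_comm, add_sub_add_right_eq_sub] at this
    · exact absurd hp (by simp)
  have hne : ∃ c : ℝ, 0 < c ∧ loewnerLE ρ (c • σ) := ⟨_, by positivity, hle 1 one_pos⟩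
  rw [Dmax, if_pos hne, EReal.coe_le_coe_iff, Real.log_le_iff_le_exp (inf_pos hρ hσ hne)]
  exact le_of_forall_pos_le_add fun δ hδ => csInf_le bdd ⟨by positivity, hle δ hδ⟩

lemma posSemidef_matPow_sandwich {ρ σ : Matrix ι ι ℂ} (hρ : ρ.PosSemidef) (hσ : σ.PosSemidef) (x y : ℝ) :
    (matPow σ x * matPow ρ y * matPow σ x).PosSemidef := by
  have := (matPow_posSemidef hρ y).mul_mul_conjTranspose_same (matPow σ x)
  rwa [(matPow_posSemidef hσ x).1.eq] at this

lemma Qaz_nonneg {ρ σ : Matrix ι ι ℂ} (hρ : ρ.PosSemidef) (hσ : σ.PosSemidef) (α z : ℝ) :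
    0 ≤ Qaz α z ρ σ :=
  reTrace_nonneg (matPow_posSemidef (posSemidef_matPow_sandwich hρ hσ _ _) z)

lemma tendsto_matPow {X : Type*} {l : Filter X} {a : X → Matrix ι ι ℂ} {A : Matrix ι ι ℂ}
    {x : ℝ} (hx : 0 < x) (ha : Tendsto a l (𝓝 A)) (hpos : ∀ᶠ t in l, (a t).PosSemidef)
    (hA : A.PosSemidef) : Tendsto (fun t => matPow (a t) x) l (𝓝 (matPow A x)) := by
  simp only [matPow_eq_cfc, suppPow_of_pos hx]
  exact tendsto_cfc_of_posSemidef (Real.continuous_rpow_const hx.le).continuousOn ha hpos hA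

/-- Closedness of the sublevel sets of `Daz` for `α < 1`. -/
lemma Daz_le_of_lt_one {α z : ℝ} (hα : 0 < α) (hz : 0 < z) (hα1 : α < 1)
    {ρ σ : Matrix ι ι ℂ} (hρ : PSDne ρ) (hσ : PSDne σ)
    {U : Filter (Matrix ι ι ℂ × Matrix ι ι ℂ)} [U.NeBot] (h1 : Tendsto Prod.fst U (𝓝 ρ))
    (h2 : Tendsto Prod.snd U (𝓝 σ)) (hU : ∀ᶠ p in U, PSDne p.1 ∧ PSDne p.2) {y : ℝ}
    (hy : ∀ᶠ p in U, Daz α z p.1 p.2 ≤ y) : Daz α z ρ σ ≤ y := by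
  have hρ' : Tendsto (fun p => matPow p.1 (α / z)) U (𝓝 (matPow ρ (α / z))) :=
    tendsto_matPow (by positivity) h1 (hU.mono fun p hp => hp.1.1) hρ.1
  have hs : 0 < (1 - α) / (2 * z) := div_pos (sub_pos.mpr hα1) (by positivity)
  have hσ' : Tendsto (fun p => matPow p.2 ((1 - α) / (2 * z))) U
      (𝓝 (matPow σ ((1 - α) / (2 * z)))) :=
    tendsto_matPow hs h2 (hU.mono fun p hp => hp.2.1) hσ.1
  have hQ : Tendsto (fun p => Qaz α z p.1 p.2) U (𝓝 (Qaz α z ρ σ)) :=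
    (continuous_reTrace.tendsto _).comp <| tendsto_matPow hz ((hσ'.mul hρ').mul hσ')
      (hU.mono fun p hp => posSemidef_matPow_sandwich hp.1.1 hp.2.1 _ _) (posSemidef_matPow_sandwich hρ.1 hσ.1 _ _)
  have equiv : ∀ {ρ σ : Matrix ι ι ℂ}, PSDne ρ → PSDne σ → Qaz α z ρ σ ≠ 0 →
      ((α - 1)⁻¹ * (Real.log (Qaz α z ρ σ) - Real.log (reTrace ρ)) ≤ y ↔
        Real.exp (y * (α - 1)) * reTrace ρ ≤ Qaz α z ρ σ) := by
    intro ρ σ hρ hσ h0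
    have hpos := lt_of_le_of_ne (Qaz_nonneg hρ.1 hσ.1 α z) (Ne.symm h0)
    rw [inv_mul_eq_div, div_le_iff_of_neg (sub_neg.mpr hα1), ← Real.log_div h0 (reTrace_pos hρ).ne',
      Real.le_log_iff_exp_le (div_pos hpos (reTrace_pos hρ)), le_div_iff₀ (reTrace_pos hρ)]
  have hle : Real.exp (y * (α - 1)) * reTrace ρ ≤ Qaz α z ρ σ := by
    refine le_of_tendsto_of_tendsto
      (((continuous_reTrace.tendsto _).comp h1).const_mul (Real.exp (y * (α - 1)))) hQ ?_
    filter_upwards [hy, hU] with p hp ⟨hp1, hp2⟩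
    unfold Daz at hp
    split_ifs at hp with hc
    · rwa [EReal.coe_le_coe_iff, equiv hp1 hp2 hc.2] at hp
    · exact absurd hp (by simp)
  have h0 : Qaz α z ρ σ ≠ 0 := (lt_of_lt_of_le (mul_pos (Real.exp_pos _) (reTrace_pos hρ)) hle).ne'
  rw [Daz, if_pos ⟨Or.inr hα1, h0⟩, EReal.coe_le_coe_iff]
  exact (equiv hρ hσ h0).mpr hle

lemma matPow_zero_mul_of_suppLE {ρ σ : Matrix ι ι ℂ} (hρ : ρ.PosSemidef) (hσ : σ.PosSemidef)
    (h : suppLE ρ σ) : matPow σ 0 * ρ = ρ := by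
  have hσP : σ * matPow σ 0 = σ := by
    simpa [matPow_one hσ] using matPow_mul hσ 1 0
  have hρP : ρ * matPow σ 0 = ρ := by
    refine Matrix.ext_of_mulVec_single fun i => ?_
    have h1 := h ((1 - matPow σ 0).mulVec (Pi.single i 1))
      (by rw [Matrix.mulVec_mulVec, Matrix.mul_sub, hσP, mul_one, sub_self, Matrix.zero_mulVec])
    rw [Matrix.mulVec_mulVec, Matrix.mul_sub, mul_one, Matrix.sub_mulVec, sub_eq_zero] at h1
    exact h1.symm
  have := congrArg Matrix.conjTranspose hρP
  rwa [Matrix.conjTranspose_mul, hρ.1.eq, (matPow_posSemidef hσ 0).1.eq] at this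

/-- Inverting the sandwiching by negative powers of `σ` when `supp ρ ≤ supp σ`. -/
lemma matPow_mul_sandwich_mul {ρ σ : Matrix ι ι ℂ} (hρ : ρ.PosSemidef) (hσ : σ.PosSemidef)
    (h : suppLE ρ σ) (s x : ℝ) :
    matPow σ s * (matPow σ (-s) * matPow ρ x * matPow σ (-s)) * matPow σ s = matPow ρ x := by
  have hPR : matPow σ 0 * matPow ρ x = matPow ρ x := by
    have hR : ρ * matPow ρ (x - 1) = matPow ρ x := by
      simpa [matPow_one hρ] using matPow_mul hρ 1 (x - 1)
    rw [← hR, ← Matrix.mul_assoc, matPow_zero_mul_of_suppLE hρ hσ h]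
  have hRP : matPow ρ x * matPow σ 0 = matPow ρ x := by
    have := congrArg Matrix.conjTranspose hPR
    rwa [Matrix.conjTranspose_mul, (matPow_posSemidef hρ x).1.eq,
      (matPow_posSemidef hσ 0).1.eq] at this
  have e1 : matPow σ s * matPow σ (-s) = matPow σ 0 := by rw [matPow_mul hσ, add_neg_cancel]
  have e2 : matPow σ (-s) * matPow σ s = matPow σ 0 := by rw [matPow_mul hσ, neg_add_cancel]
  calc _ = matPow σ s * matPow σ (-s) * matPow ρ x * (matPow σ (-s) * matPow σ s) := by
        noncomm_ring
    _ = matPow ρ x := by rw [e1, e2, hPR, hRP]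

lemma eigenvalues_le_of_reTrace_matPow_le {A : Matrix ι ι ℂ} (hA : A.PosSemidef) {z C : ℝ}
    (hz : 0 < z) (h : reTrace (matPow A z) ≤ C) (i : ι) : hA.1.eigenvalues i ≤ C ^ z⁻¹ := by
  rw [matPow_eq_cfc, reTrace_cfc hA.1, suppPow_of_pos hz] at h
  have h1 : hA.1.eigenvalues i ^ z ≤ C :=
    (Finset.single_le_sum (f := fun i => hA.1.eigenvalues i ^ z)
      (fun j _ => Real.rpow_nonneg (hA.eigenvalues_nonneg j) z) (Finset.mem_univ i)).trans h
  have h0 := Real.rpow_nonneg (hA.eigenvalues_nonneg i) z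
  exact (Real.le_rpow_inv_iff_of_pos (hA.eigenvalues_nonneg i) (h0.trans h1) hz).mpr h1

/-- Closedness of the sublevel sets of `Daz` for `1 < α`. -/
lemma Daz_le_of_one_lt {α z : ℝ} (hz : 0 < z) (hα1 : 1 < α)
    {ρ σ : Matrix ι ι ℂ} (hρ : PSDne ρ) (hσ : PSDne σ)
    {U : Ultrafilter (Matrix ι ι ℂ × Matrix ι ι ℂ)}
    (h1 : Tendsto Prod.fst (U : Filter (Matrix ι ι ℂ × Matrix ι ι ℂ)) (𝓝 ρ))
    (h2 : Tendsto Prod.snd (U : Filter (Matrix ι ι ℂ × Matrix ι ι ℂ)) (𝓝 σ))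
    (hU : ∀ᶠ p in (U : Filter (Matrix ι ι ℂ × Matrix ι ι ℂ)), PSDne p.1 ∧ PSDne p.2) {y : ℝ}
    (hy : ∀ᶠ p in (U : Filter (Matrix ι ι ℂ × Matrix ι ι ℂ)), Daz α z p.1 p.2 ≤ y) :
    Daz α z ρ σ ≤ y := by
  obtain ⟨s, hs⟩ : ∃ s, s = (α - 1) / (2 * z) := ⟨_, rfl⟩
  have hs0 : 0 < s := hs ▸ div_pos (sub_pos.mpr hα1) (by positivity)
  have hs' : (1 - α) / (2 * z) = -s := by rw [hs]; ring
  have hx : 0 < α / z := div_pos (zero_lt_one.trans hα1) hz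
  let Y : Matrix ι ι ℂ × Matrix ι ι ℂ → Matrix ι ι ℂ := fun p =>
    matPow p.2 (-s) * matPow p.1 (α / z) * matPow p.2 (-s)
  have hQY : ∀ p, Qaz α z p.1 p.2 = reTrace (matPow (Y p) z) := fun p => by rw [Qaz, hs']
  have equiv : ∀ {ρ σ : Matrix ι ι ℂ}, PSDne ρ → PSDne σ → Qaz α z ρ σ ≠ 0 →
      ((α - 1)⁻¹ * (Real.log (Qaz α z ρ σ) - Real.log (reTrace ρ)) ≤ y ↔
        Qaz α z ρ σ ≤ Real.exp (y * (α - 1)) * reTrace ρ) := by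
    intro ρ σ hρ hσ h0
    have hpos := lt_of_le_of_ne (Qaz_nonneg hρ.1 hσ.1 α z) (Ne.symm h0)
    rw [inv_mul_eq_div, div_le_iff₀ (sub_pos.mpr hα1), ← Real.log_div h0 (reTrace_pos hρ).ne',
      Real.log_le_iff_le_exp (div_pos hpos (reTrace_pos hρ)), div_le_iff₀ (reTrace_pos hρ)]
  have hev : ∀ᶠ p in (U : Filter (Matrix ι ι ℂ × Matrix ι ι ℂ)), suppLE p.1 p.2 ∧
      Qaz α z p.1 p.2 ≤ Real.exp (y * (α - 1)) * reTrace p.1 := by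
    filter_upwards [hy, hU] with p hp ⟨hp1, hp2⟩
    unfold Daz at hp
    split_ifs at hp with hc
    · rw [EReal.coe_le_coe_iff, equiv hp1 hp2 hc.2] at hp
      exact ⟨hc.1.resolve_right hα1.not_gt, hp⟩
    · exact absurd hp (by simp)
  have htr : Tendsto (fun p : Matrix ι ι ℂ × Matrix ι ι ℂ => reTrace p.1) U (𝓝 (reTrace ρ)) :=
    (continuous_reTrace.tendsto _).comp h1
  obtain ⟨K, hK, hmem⟩ := isCompact_posSemidef_eigenvalues_le (ι := ι)
    ((Real.exp (y * (α - 1)) * (reTrace ρ + 1)) ^ z⁻¹)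
  have hYpos : ∀ᶠ p in (U : Filter (Matrix ι ι ℂ × Matrix ι ι ℂ)), (Y p).PosSemidef :=
    hU.mono fun p hp => posSemidef_matPow_sandwich hp.1.1 hp.2.1 _ _
  have hYK : ∀ᶠ p in (U : Filter (Matrix ι ι ℂ × Matrix ι ι ℂ)), Y p ∈ K := by
    filter_upwards [hev, hYpos, htr.eventually_lt_const (lt_add_one _)] with p ⟨_, hp⟩ hpY hpt
    rw [hQY] at hp
    refine hmem _ hpY (eigenvalues_le_of_reTrace_matPow_le hpY hz (hp.trans ?_))
    gcongr
  obtain ⟨L, -, hL⟩ := hK.ultrafilter_le_nhds (U.map Y) (le_principal_iff.mpr hYK)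
  replace hL : Tendsto Y U (𝓝 L) := hL
  have hLpos : L.PosSemidef := isClosed_posSemidef.mem_of_tendsto hL hYpos
  have hLtr : reTrace (matPow L z) ≤ Real.exp (y * (α - 1)) * reTrace ρ := by
    refine le_of_tendsto_of_tendsto ((continuous_reTrace.tendsto _).comp
      (tendsto_matPow hz hL hYpos hLpos)) (htr.const_mul _) ?_
    filter_upwards [hev] with p hp
    rw [Function.comp_apply, ← hQY]
    exact hp.2
  have hR : matPow σ s * L * matPow σ s = matPow ρ (α / z) := by
    have hS : Tendsto (fun p : Matrix ι ι ℂ × Matrix ι ι ℂ => matPow p.2 s) U (𝓝 (matPow σ s)) :=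
      tendsto_matPow hs0 h2 (hU.mono fun p hp => hp.2.1) hσ.1
    refine tendsto_nhds_unique ((hS.mul hL).mul hS) <|
      (tendsto_matPow hx h1 (hU.mono fun p hp => hp.1.1) hρ.1).congr' ?_
    filter_upwards [hU, hev] with p hp hp'
    exact (matPow_mul_sandwich_mul hp.1.1 hp.2.1 hp'.1 s _).symm
  have hρR : matPow ρ (1 - α / z) * matPow ρ (α / z) = ρ := by
    rw [matPow_mul hρ.1, sub_add_cancel, matPow_one hρ.1]
  have hsupp : suppLE ρ σ := by
    intro v hv
    have hSσ : matPow σ (s - 1) * σ = matPow σ s := by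
      simpa [matPow_one hσ.1] using matPow_mul hσ.1 (s - 1) 1
    rw [← hρR, ← hR, ← hSσ]
    simp only [← Matrix.mulVec_mulVec, hv, Matrix.mulVec_zero]
  have hP : matPow σ (-s) * matPow ρ (α / z) * matPow σ (-s) =
      matPow σ 0 * L * matPow σ 0 := by
    have e1 : matPow σ s * matPow σ (-s) = matPow σ 0 := by
      rw [matPow_mul hσ.1, add_neg_cancel]
    have e2 : matPow σ (-s) * matPow σ s = matPow σ 0 := by
      rw [matPow_mul hσ.1, neg_add_cancel]
    calc _ = matPow σ (-s) * matPow σ s * L * (matPow σ s * matPow σ (-s)) := by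
          rw [← hR]
          noncomm_ring
      _ = _ := by rw [e1, e2]
  have hle : Qaz α z ρ σ ≤ Real.exp (y * (α - 1)) * reTrace ρ := by
    refine le_trans ?_ hLtr
    rw [Qaz, hs', hP, matPow_eq_cfc _ z, matPow_eq_cfc L z]
    refine reTrace_cfc_compression_le (matPow_posSemidef hσ.1 0).1
      (by rw [matPow_mul hσ.1, add_zero]) hLpos ?_
    rw [suppPow_of_pos hz]
    exact fun a ha b _ hab => Real.rpow_le_rpow ha hab hz.le
  have h0 : Qaz α z ρ σ ≠ 0 := by
    intro h0
    have hYρ : (Y (ρ, σ)).PosSemidef := posSemidef_matPow_sandwich hρ.1 hσ.1 _ _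
    rw [hQY (ρ, σ)] at h0
    have hz0 : matPow (Y (ρ, σ)) z = 0 := by
      by_contra hne
      exact (reTrace_pos ⟨matPow_posSemidef hYρ z, hne⟩).ne' h0
    have hY0 : Y (ρ, σ) = 0 := by
      rw [← matPow_one hYρ, ← sub_add_cancel 1 z, ← matPow_mul hYρ, hz0, mul_zero]
    have hR0 := matPow_mul_sandwich_mul hρ.1 hσ.1 hsupp s (α / z)
    refine hρ.2 ?_
    rw [← hρR, ← hR0, show matPow σ (-s) * matPow ρ (α / z) * matPow σ (-s) = 0 from hY0]
    simp
  rw [Daz, if_pos ⟨Or.inl hsupp, h0⟩, EReal.coe_le_coe_iff]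
  exact (equiv hρ hσ h0).mpr hle

lemma posSemidef_conj_eigenvectorUnitary {ρ σ : Matrix ι ι ℂ} (hρ : ρ.PosSemidef) (hσ : σ.IsHermitian) :
    ((hσ.eigenvectorUnitary : Matrix ι ι ℂ).conjTranspose * ρ *
      (hσ.eigenvectorUnitary : Matrix ι ι ℂ)).PosSemidef :=
  hρ.conjTranspose_mul_mul_same _

lemma eigenWeight_nonneg {ρ σ : Matrix ι ι ℂ} (hρ : ρ.PosSemidef) (hσ : σ.IsHermitian) (i : ι) :
    0 ≤ eigenWeight hσ ρ i :=
  (Complex.le_def.mp (posSemidef_conj_eigenvectorUnitary hρ hσ).diag_nonneg).1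

lemma eigenWeight_eq_zero_iff {ρ σ : Matrix ι ι ℂ} (hρ : ρ.PosSemidef) (hσ : σ.IsHermitian)
    (i : ι) : eigenWeight hσ ρ i = 0 ↔
      ρ.mulVec ((hσ.eigenvectorUnitary : Matrix ι ι ℂ).mulVec (Pi.single i 1)) = 0 := by
  set U : Matrix ι ι ℂ := (hσ.eigenvectorUnitary : Matrix ι ι ℂ) with hU
  rw [← hρ.dotProduct_mulVec_zero_iff]
  have h : star (U.mulVec (Pi.single i 1)) ⬝ᵥ ρ.mulVec (U.mulVec (Pi.single i 1)) =
      (U.conjTranspose * ρ * U) i i := by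
    rw [Matrix.star_mulVec, ← Matrix.dotProduct_mulVec, Matrix.mulVec_mulVec,
      Matrix.mulVec_mulVec, Pi.star_single, star_one,
      single_one_dotProduct, Matrix.mulVec_single_one, Matrix.col_apply]
  have h0 := Complex.le_def.mp
    (Matrix.PosSemidef.diag_nonneg (posSemidef_conj_eigenvectorUnitary hρ hσ) (i := i))
  rw [h, eigenWeight, Complex.ext_iff]
  exact ⟨fun hre => ⟨hre, h0.2.symm⟩, fun hz => hz.1⟩

lemma suppLE_iff_eigenWeight {ρ σ : Matrix ι ι ℂ} (hρ : ρ.PosSemidef) (hσ : σ.IsHermitian) :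
    suppLE ρ σ ↔ ∀ i, hσ.eigenvalues i = 0 → eigenWeight hσ ρ i = 0 := by
  have hid : σ = cfc (fun t : ℝ => t) σ := (cfc_id' ℝ σ hσ).symm
  rw [cfc_eq_conj hσ] at hid
  have h1 : (hσ.eigenvectorUnitary : Matrix ι ι ℂ) *
      (hσ.eigenvectorUnitary : Matrix ι ι ℂ).conjTranspose = 1 :=
    Unitary.mul_star_self_of_mem hσ.eigenvectorUnitary.2
  have h2 : (hσ.eigenvectorUnitary : Matrix ι ι ℂ).conjTranspose *
      (hσ.eigenvectorUnitary : Matrix ι ι ℂ) = 1 :=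
    Unitary.star_mul_self_of_mem hσ.eigenvectorUnitary.2
  have hiff := eigenWeight_eq_zero_iff hρ hσ
  set U : Matrix ι ι ℂ := (hσ.eigenvectorUnitary : Matrix ι ι ℂ) with hU
  constructor
  · intro h i hi
    rw [hiff]
    apply h
    rw [hid, Matrix.mulVec_mulVec, Matrix.mul_assoc, h2, mul_one, ← Matrix.mulVec_mulVec]
    have : (Matrix.diagonal fun i => (hσ.eigenvalues i : ℂ)).mulVec (Pi.single i 1) = 0 := by
      ext j
      rw [Matrix.mulVec_diagonal]
      by_cases hj : j = i
      · simp [hj, hi]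
      · simp [hj]
    rw [this, Matrix.mulVec_zero]
  · intro h v hv
    have hD : (Matrix.diagonal fun i => (hσ.eigenvalues i : ℂ)).mulVec
        (U.conjTranspose.mulVec v) = 0 := by
      have := congrArg U.conjTranspose.mulVec hv
      rw [hid, Matrix.mulVec_mulVec, ← Matrix.mul_assoc, ← Matrix.mul_assoc, h2, one_mul,
        Matrix.mulVec_zero] at this
      rwa [Matrix.mulVec_mulVec]
    have hv' : v = U.mulVec (U.conjTranspose.mulVec v) := by
      rw [Matrix.mulVec_mulVec, h1, Matrix.one_mulVec]
    rw [hv', Matrix.mulVec_mulVec, Matrix.mulVec_eq_sum]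
    refine Finset.sum_eq_zero fun i _ => ?_
    have hDi := congrFun hD i
    rw [Matrix.mulVec_diagonal, Pi.zero_apply, mul_eq_zero] at hDi
    rcases hDi with hi | hi
    · have := (hiff i).mp (h i (Complex.ofReal_eq_zero.mp hi))
      rw [Matrix.mulVec_mulVec, Matrix.mulVec_single_one] at this
      rw [show (ρ * U).transpose i = 0 from this, smul_zero]
    · rw [hi, MulOpposite.op_zero, zero_smul]

/-- Regularizing the logarithm increases `Tr ρ log σ` when `supp ρ ≤ supp σ`. -/
lemma reTrace_mul_log_le {ρ σ : Matrix ι ι ℂ} (hρ : ρ.PosSemidef) (hσ : σ.PosSemidef)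
    (h : suppLE ρ σ) {ε : ℝ} (hε : 0 < ε) :
    reTrace (ρ * cfc Real.log σ) ≤ reTrace (ρ * cfc (fun t => Real.log (t + ε)) σ) := by
  rw [suppLE_iff_eigenWeight hρ hσ.1] at h
  simp only [reTrace_mul_cfc hσ.1]
  refine Finset.sum_le_sum fun i _ => ?_
  rcases (hσ.eigenvalues_nonneg i).eq_or_lt with h0 | h0
  · rw [h i h0.symm, mul_zero, mul_zero]
  · exact mul_le_mul_of_nonneg_right (Real.log_le_log h0 (by linarith))
      (eigenWeight_nonneg hρ hσ.1 i)

/-- If a weighted sum of regularized logarithms stays bounded below, the weights vanish on the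
zeros, and the bound persists without the regularization. -/
lemma sum_log_of_forall_sum_log_add {s r : ι → ℝ} (hs : ∀ i, 0 ≤ s i) (hr : ∀ i, 0 ≤ r i)
    {C : ℝ} (h : ∀ ε : ℝ, 0 < ε → C ≤ ∑ i, Real.log (s i + ε) * r i) :
    (∀ i, s i = 0 → r i = 0) ∧ C ≤ ∑ i, Real.log (s i) * r i := by
  have hzero : ∀ i, s i = 0 → r i = 0 := by
    intro i hi
    by_contra hri
    have hri' := lt_of_le_of_ne (hr i) (Ne.symm hri)
    have hbound : ∀ᶠ ε in 𝓝[>] (0 : ℝ),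
        C ≤ Real.log ε * r i + ∑ j ∈ Finset.univ.erase i, Real.log (s j + 1) * r j := by
      filter_upwards [Ioo_mem_nhdsGT (zero_lt_one (α := ℝ))] with ε hε
      refine (h ε hε.1).trans ?_
      rw [← Finset.add_sum_erase _ _ (Finset.mem_univ i), hi, zero_add]
      gcongr with j
      · exact hr j
      · exact add_pos_of_nonneg_of_pos (hs j) hε.1
      · exact hε.2.le
    have hlim : Tendsto (fun ε => Real.log ε * r i +
        ∑ j ∈ Finset.univ.erase i, Real.log (s j + 1) * r j) (𝓝[>] (0 : ℝ)) atBot :=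
      tendsto_atBot_add_const_right _ _
        (Real.tendsto_log_nhdsGT_zero.atBot_mul_const hri')
    obtain ⟨ε, h1, h2⟩ := (hbound.and (hlim.eventually_lt_atBot C)).exists
    exact h1.not_gt h2
  refine ⟨hzero, ?_⟩
  have hlim : Tendsto (fun ε => ∑ i, Real.log (s i + ε) * r i) (𝓝[>] (0 : ℝ))
      (𝓝 (∑ i, Real.log (s i) * r i)) := by
    refine tendsto_finsetSum _ fun i _ => ?_
    by_cases hi : s i = 0
    · simp [hzero i hi]
    · have hadd : Tendsto (fun ε : ℝ => s i + ε) (𝓝[>] 0) (𝓝 (s i)) := by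
        have : Tendsto (fun ε : ℝ => s i + ε) (𝓝 0) (𝓝 (s i + 0)) :=
          tendsto_const_nhds.add tendsto_id
        rw [add_zero] at this
        exact this.mono_left nhdsWithin_le_nhds
      exact ((Real.continuousAt_log hi).tendsto.comp hadd).mul_const _
  exact ge_of_tendsto hlim (by filter_upwards [self_mem_nhdsWithin] with ε hε using h ε hε)

/-- Closedness of the sublevel sets of the Umegaki relative entropy. -/
lemma DUm_le_of_tendsto {ρ σ : Matrix ι ι ℂ} (hρ : PSDne ρ) (hσ : PSDne σ)
    {U : Filter (Matrix ι ι ℂ × Matrix ι ι ℂ)} [U.NeBot] (h1 : Tendsto Prod.fst U (𝓝 ρ))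
    (h2 : Tendsto Prod.snd U (𝓝 σ)) (hU : ∀ᶠ p in U, PSDne p.1 ∧ PSDne p.2) {y : ℝ}
    (hy : ∀ᶠ p in U, DUm p.1 p.2 ≤ y) : DUm ρ σ ≤ y := by
  have hself : ∀ {ρ : Matrix ι ι ℂ}, ρ.PosSemidef →
      ρ * cfc Real.log ρ = cfc (fun t => t * Real.log t) ρ := by
    intro ρ hρ
    have hid : cfc (fun t : ℝ => t) ρ = ρ := cfc_id' ℝ ρ hρ.1
    have := cfc_mul_cfc (fun t : ℝ => t) Real.log ρ
    rwa [hid] at this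
  have equiv : ∀ {ρ σ : Matrix ι ι ℂ}, PSDne ρ →
      ((reTrace ρ)⁻¹ * reTrace (ρ * (matLog ρ - matLog σ)) ≤ y ↔
        reTrace (cfc (fun t => t * Real.log t) ρ) - reTrace ρ * y ≤
          reTrace (ρ * cfc Real.log σ)) := by
    intro ρ σ hρ
    rw [inv_mul_le_iff₀ (reTrace_pos hρ), matLog, matLog, hermApply_eq_cfc, hermApply_eq_cfc,
      Matrix.mul_sub, hself hρ.1, reTrace, Matrix.trace_sub, Complex.sub_re, sub_le_comm]
    rfl
  have hF : Tendsto (fun p : Matrix ι ι ℂ × Matrix ι ι ℂ =>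
      reTrace (cfc (fun t => t * Real.log t) p.1) - reTrace p.1 * y) U
      (𝓝 (reTrace (cfc (fun t => t * Real.log t) ρ) - reTrace ρ * y)) :=
    ((continuous_reTrace.tendsto _).comp (tendsto_cfc_of_posSemidef
      Real.continuous_mul_log.continuousOn h1 (hU.mono fun p hp => hp.1.1) hρ.1)).sub
      (((continuous_reTrace.tendsto _).comp h1).mul_const y)
  have hle : ∀ ε : ℝ, 0 < ε → reTrace (cfc (fun t => t * Real.log t) ρ) - reTrace ρ * y ≤
      ∑ i, Real.log (hσ.1.1.eigenvalues i + ε) * eigenWeight hσ.1.1 ρ i := by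
    intro ε hε
    rw [← reTrace_mul_cfc hσ.1.1 ρ fun t => Real.log (t + ε)]
    have hlog : ContinuousOn (fun t => Real.log (t + ε)) (Ici 0) :=
      ContinuousOn.log (by fun_prop) fun t ht => (add_pos_of_nonneg_of_pos ht hε).ne'
    refine le_of_tendsto_of_tendsto hF ((continuous_reTrace.tendsto _).comp
      (h1.mul (tendsto_cfc_of_posSemidef hlog h2 (hU.mono fun p hp => hp.2.1) hσ.1))) ?_
    filter_upwards [hy, hU] with p hp ⟨hp1, hp2⟩
    unfold DUm at hp
    split_ifs at hp with hc
    · rw [EReal.coe_le_coe_iff, equiv hp1] at hp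
      exact hp.trans (reTrace_mul_log_le hp1.1 hp2.1 hc hε)
    · exact absurd hp (by simp)
  obtain ⟨hz, hC⟩ := sum_log_of_forall_sum_log_add hσ.1.eigenvalues_nonneg
    (eigenWeight_nonneg hρ.1 hσ.1.1) hle
  rw [DUm, if_pos ((suppLE_iff_eigenWeight hρ.1 hσ.1.1).mpr hz), EReal.coe_le_coe_iff, equiv hρ,
    reTrace_mul_cfc hσ.1.1]
  exact hC

/-- For every `α, z ∈ (0,∞)`, the Rényi `(α,z)`-divergence
(with `D_{1,z} := D^Um`) and the max-relative entropy are lower semicontinuous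
on pairs of nonzero PSD operators. -/
theorem renyi_az_and_Dmax_lowerSemicontinuousOn (n : ℕ) (α z : ℝ) (hα : 0 < α) (hz : 0 < z) :
    LowerSemicontinuousOn
      (fun p : Matrix (Fin n) (Fin n) ℂ × Matrix (Fin n) (Fin n) ℂ => Dfull α z p.1 p.2)
      {p : Matrix (Fin n) (Fin n) ℂ × Matrix (Fin n) (Fin n) ℂ | PSDne p.1 ∧ PSDne p.2} ∧
    LowerSemicontinuousOn
      (fun p : Matrix (Fin n) (Fin n) ℂ × Matrix (Fin n) (Fin n) ℂ => Dmax p.1 p.2)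
      {p : Matrix (Fin n) (Fin n) ℂ × Matrix (Fin n) (Fin n) ℂ | PSDne p.1 ∧ PSDne p.2} := by
  have tends : ∀ {x : Matrix (Fin n) (Fin n) ℂ × Matrix (Fin n) (Fin n) ℂ}
      {s : Set (Matrix (Fin n) (Fin n) ℂ × Matrix (Fin n) (Fin n) ℂ)}
      {U : Filter (Matrix (Fin n) (Fin n) ℂ × Matrix (Fin n) (Fin n) ℂ)}, U ≤ 𝓝[s] x →
      Tendsto Prod.fst U (𝓝 x.1) ∧ Tendsto Prod.snd U (𝓝 x.2) ∧ ∀ᶠ p in U, p ∈ s := by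
    intro x s U hU
    have hx : U ≤ 𝓝 x := hU.trans nhdsWithin_le_nhds
    exact ⟨(continuous_fst.tendsto x).mono_left hx, (continuous_snd.tendsto x).mono_left hx,
      hU self_mem_nhdsWithin⟩
  refine ⟨lowerSemicontinuousOn_of_ultrafilter fun x hx U hU y hy => ?_,
    lowerSemicontinuousOn_of_ultrafilter fun x hx U hU y hy => ?_⟩
  · obtain ⟨h1, h2, h3⟩ := tends hU
    unfold Dfull at hy ⊢
    rcases lt_trichotomy α 1 with h | h | h
    · simp only [if_neg h.ne] at hy ⊢
      exact Daz_le_of_lt_one hα hz h hx.1 hx.2 h1 h2 h3 hy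
    · simp only [if_pos h] at hy ⊢
      exact DUm_le_of_tendsto hx.1 hx.2 h1 h2 h3 hy
    · simp only [if_neg h.ne'] at hy ⊢
      exact Daz_le_of_one_lt hz h hx.1 hx.2 h1 h2 h3 hy
  · obtain ⟨h1, h2, h3⟩ := tends hU
    exact Dmax_le_of_tendsto hx.1 hx.2 h1 h2 h3 hy

end QRenyi

end
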